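/- Given an upper contact jet (p₀, A₀) for w = u + v at x₀ (u, v quasi-convex near x₀), there exist jets (p, A') ∈ closure of J⁺(u) at x₀ and (q, B) ∈ closure of J⁺(v) at x₀ with values u(x₀) and v(x₀) respectively, such that p + q = p₀ and A' + B = A₀. -/

import Mathlib

open scoped RealInnerProductSpace Topology
open Filter MeasureTheory

/-- The quadratic form `⟨A v, v⟩` associated to a matrix `A`. -/
noncomputable def quad {n : ℕ} (A : Matrix (Fin n) (Fin n) ℝ)
    (v : EuclideanSpace ℝ (Fin n)) : ℝ :=
  ∑ i, ∑ j, A i j * v i * v j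

/-- `(p, A)` is an upper contact jet for `w` at `x₀`. -/
def UpperContactJet {n : ℕ} (w : EuclideanSpace ℝ (Fin n) → ℝ)
    (x₀ p : EuclideanSpace ℝ (Fin n)) (A : Matrix (Fin n) (Fin n) ℝ) : Prop :=
  ∀ᶠ y in 𝓝 x₀, w y ≤ w x₀ + ⟪p, y - x₀⟫ + (1 / 2) * quad A (y - x₀)

/-- `w` is twice differentiable at `x` with gradient `g` and Hessian `H`, in the sense of
a second-order Taylor expansion. -/
def TwiceDiffAt {n : ℕ} (w : EuclideanSpace ℝ (Fin n) → ℝ)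
    (x g : EuclideanSpace ℝ (Fin n)) (H : Matrix (Fin n) (Fin n) ℝ) : Prop :=
  HasGradientAt w g x ∧
    (fun y => w y - w x - ⟪g, y - x⟫ - (1 / 2) * quad H (y - x)) =o[𝓝 x]
      fun y => ‖y - x‖ ^ 2

/-- `w` is `lam`-quasi-convex on `U`: `w + (lam/2)|·|²` is convex on `U`. -/
def QCOn {n : ℕ} (lam : ℝ) (U : Set (EuclideanSpace ℝ (Fin n)))
    (w : EuclideanSpace ℝ (Fin n) → ℝ) : Prop :=
  ConvexOn ℝ U (fun x => w x + (lam / 2) * ‖x‖ ^ 2)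

/-- The 2-jet space `ℝⁿ × ℝ × ℝⁿ × Sym²(ℝⁿ)` (symmetry imposed separately). -/
abbrev Jet (n : ℕ) :=
  EuclideanSpace ℝ (Fin n) × ℝ × EuclideanSpace ℝ (Fin n) × Matrix (Fin n) (Fin n) ℝ

/-- Positivity condition (P) for a set of 2-jets. -/
def Positivity {n : ℕ} (F : Set (Jet n)) : Prop :=
  ∀ x : EuclideanSpace ℝ (Fin n), ∀ r : ℝ, ∀ p : EuclideanSpace ℝ (Fin n),
    ∀ A P : Matrix (Fin n) (Fin n) ℝ,
      (x, r, p, A) ∈ F → P.PosSemidef → (x, r, p, A + P) ∈ F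

/-- `u` is `F`-subharmonic on `U`: every upper contact jet of `u` at a point of `U`
belongs to `F`. -/
def Subharm {n : ℕ} (F : Set (Jet n)) (U : Set (EuclideanSpace ℝ (Fin n)))
    (u : EuclideanSpace ℝ (Fin n) → ℝ) : Prop :=
  ∀ x ∈ U, ∀ (p : EuclideanSpace ℝ (Fin n)) (A : Matrix (Fin n) (Fin n) ℝ),
    A.IsSymm → UpperContactJet u x p A → (x, u x, p, A) ∈ F


theorem tendsto_const_add_nhds_zero {V : Type*} [NormedAddCommGroup V] (x : V) :
    Tendsto (fun h : V => x + h) (𝓝 0) (𝓝 x) := by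
  simpa using (continuous_const.add continuous_id).tendsto (0 : V) (f := fun h : V => x + h)

section QuadraticApproximation

variable {V : Type*} [NormedAddCommGroup V] [InnerProductSpace ℝ V]

/-- On `S`, the function `f` stays within `K ‖y - x‖²` of the affine function
`y ↦ f x + ⟪a, y - x⟫`. -/
def QuadApproxOn (K : ℝ) (S : Set V) (f : V → ℝ) (x a : V) : Prop :=
  ∀ y ∈ S, |f y - f x - ⟪a, y - x⟫| ≤ K * ‖y - x‖ ^ 2

theorem QuadApproxOn.norm_gradient_sub_le {K R : ℝ} {f : V → ℝ} {x₀ x x' a a' : V}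
    (hx : x ∈ Metric.ball x₀ (R / 4)) (hx' : x' ∈ Metric.ball x₀ (R / 4)) (hK : 0 ≤ K)
    (h : QuadApproxOn K (Metric.ball x₀ R) f x a)
    (h' : QuadApproxOn K (Metric.ball x₀ R) f x' a') :
    ‖a' - a‖ ≤ 6 * K * ‖x' - x‖ := by
  rw [mem_ball_iff_norm] at hx hx'
  have hd : ‖x' - x‖ < R / 2 := by
    have := norm_sub_le (x' - x₀) (x - x₀)
    rw [sub_sub_sub_cancel_right] at this
    linarith
  have key : ∀ t ∈ Set.Ioo ‖x' - x‖ (R / 2), ‖a' - a‖ ≤ 6 * K * t := by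
    rintro t ⟨ht, htR⟩
    have ht0 : 0 < t := (norm_nonneg _).trans_lt ht
    rcases eq_or_ne a' a with rfl | hne
    · rw [sub_self, norm_zero]; positivity
    have hpos : 0 < ‖a' - a‖ := norm_pos_iff.2 (sub_ne_zero.2 hne)
    set e : V := (t / ‖a' - a‖) • (a' - a) with he
    have hen : ‖e‖ = t := by
      rw [he, norm_smul, Real.norm_of_nonneg (by positivity)]; field_simp
    have hinner : ⟪a' - a, e⟫ = t * ‖a' - a‖ := by
      rw [he, inner_smul_right, real_inner_self_eq_norm_sq]; field_simp
    have hy : x' + e ∈ Metric.ball x₀ R := by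
      rw [mem_ball_iff_norm]
      have := norm_add_le (x' - x₀) e
      rw [show x' + e - x₀ = x' - x₀ + e by abel]
      linarith
    have hxR : x' ∈ Metric.ball x₀ R := by
      rw [mem_ball_iff_norm]; linarith
    have h1 := (abs_le.1 (h _ hy)).2
    have h2 := (abs_le.1 (h' _ hy)).1
    have h3 := (abs_le.1 (h _ hxR)).1
    rw [add_sub_cancel_left, hen] at h2
    have hn : ‖x' + e - x‖ ≤ 2 * t := by
      have := norm_add_le (x' - x) e
      rw [show x' + e - x = x' - x + e by abel]
      linarith
    have hn1 : K * ‖x' + e - x‖ ^ 2 ≤ K * (2 * t) ^ 2 := by gcongr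
    have hn2 : K * ‖x' - x‖ ^ 2 ≤ K * t ^ 2 := by gcongr
    rw [show x' + e - x = (x' - x) + e by abel, inner_add_right] at h1
    rw [show x' + e - x = (x' - x) + e by abel] at hn1
    rw [inner_sub_left] at hinner
    have : ‖a' - a‖ * t ≤ (6 * K * t) * t := by nlinarith
    exact le_of_mul_le_mul_right this ht0
  have ht : Tendsto (fun t => 6 * K * t) (𝓝[>] ‖x' - x‖) (𝓝 (6 * K * ‖x' - x‖)) :=
    ((continuous_const.mul continuous_id).tendsto _).mono_left nhdsWithin_le_nhds
  exact ge_of_tendsto ht (Filter.mem_of_superset (Ioo_mem_nhdsGT hd) key)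

theorem ConvexOn.exists_subgradient [FiniteDimensional ℝ V] {U : Set V} (hU : IsOpen U)
    {f : V → ℝ} (hf : ConvexOn ℝ U f) {x : V} (hx : x ∈ U) :
    ∃ a : V, ∀ y ∈ U, f x + ⟪a, y - x⟫ ≤ f y := by
  have hcont : ContinuousOn f U := hf.continuousOn hU
  have hopen : IsOpen {p : V × ℝ | p.1 ∈ U ∧ f p.1 < p.2} := by
    have h1 : IsOpen (U ×ˢ (Set.univ : Set ℝ)) := hU.prod isOpen_univ
    have h2 : ContinuousOn (fun p : V × ℝ => p.2 - f p.1) (U ×ˢ Set.univ) :=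
      continuousOn_snd.sub (hcont.comp continuousOn_fst fun p hp => hp.1)
    convert h2.isOpen_inter_preimage h1 (isOpen_Ioi (a := (0 : ℝ))) using 1
    ext p; simp
  obtain ⟨F, hF⟩ := geometric_hahn_banach_open_point hf.convex_strict_epigraph hopen
    (x := (x, f x)) (by simp)
  set c : ℝ := F (0, 1) with hc
  have hdecomp : ∀ (y : V) (t : ℝ), F (y, t) = F (y, 0) + t * c := by
    intro y t
    rw [hc, ← smul_eq_mul, ← map_smul, ← map_add]; simp
  have hc0 : c < 0 := by
    have := hF (x, f x + 1) ⟨hx, by simp⟩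
    rw [hdecomp, hdecomp x (f x)] at this
    linarith
  set L : StrongDual ℝ V := (-c)⁻¹ • F.comp (ContinuousLinearMap.inl ℝ V ℝ) with hL
  refine ⟨(InnerProductSpace.toDual ℝ V).symm L, fun y hy => ?_⟩
  rw [InnerProductSpace.toDual_symm_apply]
  have hLy : L (y - x) = (-c)⁻¹ * (F (y, 0) - F (x, 0)) := by
    rw [hL, ← map_sub]; simp
  rw [hLy]
  refine le_of_forall_gt_imp_ge_of_dense fun t ht => ?_
  have := hF (y, t) ⟨hy, ht⟩
  rw [hdecomp, hdecomp x (f x)] at this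
  have h2 : (-c)⁻¹ * (F (y, 0) - F (x, 0)) ≤ (-c)⁻¹ * ((-c) * (t - f x)) := by
    have : 0 < -c := by linarith
    gcongr
    linarith
  rw [inv_mul_cancel_left₀ (by linarith)] at h2
  linarith

/-- A function which is convex up to a quadratic has a supporting paraboloid from below. -/
theorem exists_lower_paraboloid [FiniteDimensional ℝ V] {U : Set V} (hU : IsOpen U) {lam : ℝ}
    {f : V → ℝ} (hf : ConvexOn ℝ U fun x => f x + lam / 2 * ‖x‖ ^ 2) {x : V} (hx : x ∈ U) :
    ∃ a : V, ∀ y ∈ U, f x + ⟪a, y - x⟫ - lam / 2 * ‖y - x‖ ^ 2 ≤ f y := by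
  obtain ⟨a, ha⟩ := hf.exists_subgradient hU hx
  refine ⟨a - lam • x, fun y hy => ?_⟩
  have h := ha y hy
  have hn : ‖y - x‖ ^ 2 = ‖y‖ ^ 2 - 2 * ⟪x, y⟫ + ‖x‖ ^ 2 := by
    rw [norm_sub_sq_real, real_inner_comm]
  have hi : ⟪a - lam • x, y - x⟫ = ⟪a, y - x⟫ - lam * (⟪x, y⟫ - ‖x‖ ^ 2) := by
    rw [inner_sub_left, inner_smul_left, inner_sub_right x, real_inner_self_eq_norm_sq]; simp
  rw [hn, hi]
  linarith

/-- If `⟪c, h⟫ ≤ C ‖h‖²` for all small `h`, then `c = 0`. -/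
theorem eq_zero_of_inner_le_sq {c : V} {C : ℝ} (h : ∀ᶠ y in 𝓝 (0 : V), ⟪c, y⟫ ≤ C * ‖y‖ ^ 2) :
    c = 0 := by
  have ht : Tendsto (fun t : ℝ => t • c) (𝓝[>] 0) (𝓝 0) := by
    have : Tendsto (fun t : ℝ => t • c) (𝓝 0) (𝓝 ((0 : ℝ) • c)) :=
      (continuous_id.smul continuous_const).tendsto 0
    rw [zero_smul] at this
    exact this.mono_left nhdsWithin_le_nhds
  have h1 : ∀ᶠ t : ℝ in 𝓝[>] 0, ‖c‖ ^ 2 ≤ C * ‖c‖ ^ 2 * t := by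
    filter_upwards [ht.eventually h, self_mem_nhdsWithin] with t h2 h3
    rw [Set.mem_Ioi] at h3
    rw [inner_smul_right, norm_smul, real_inner_self_eq_norm_sq, Real.norm_of_nonneg h3.le] at h2
    refine le_of_mul_le_mul_left ?_ h3
    linarith
  have h2 : Tendsto (fun t => C * ‖c‖ ^ 2 * t) (𝓝[>] (0 : ℝ)) (𝓝 (C * ‖c‖ ^ 2 * 0)) :=
    ((continuous_const.mul continuous_id).tendsto _).mono_left nhdsWithin_le_nhds
  have h3 := ge_of_tendsto h2 h1
  rw [mul_zero] at h3
  exact norm_eq_zero.1 (by nlinarith [norm_nonneg c])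

/-- If two functions have lower paraboloids of opening `lam` at `x` and their sum has an upper
paraboloid of opening `C` there, then both are two-sided approximated, with compatible
gradients. -/
theorem exists_quadApproxOn_of_add_le {S : Set V} (hS : IsOpen S) {u v : V → ℝ} {x a a' b : V}
    {lam C : ℝ} (hlam : 0 ≤ lam) (hC : 0 ≤ C) (hx : x ∈ S)
    (hu : ∀ y ∈ S, u x + ⟪a, y - x⟫ - lam / 2 * ‖y - x‖ ^ 2 ≤ u y)
    (hv : ∀ y ∈ S, v x + ⟪a', y - x⟫ - lam / 2 * ‖y - x‖ ^ 2 ≤ v y)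
    (huv : ∀ y ∈ S, u y + v y ≤ u x + v x + ⟪b, y - x⟫ + C * ‖y - x‖ ^ 2) :
    a + a' = b ∧ QuadApproxOn (C + lam) S u x a ∧ QuadApproxOn (C + lam) S v x a' := by
  have hab : a + a' - b = 0 := by
    apply eq_zero_of_inner_le_sq (C := C + lam)
    filter_upwards [(tendsto_const_add_nhds_zero x).eventually (hS.mem_nhds hx)] with y hy
    have h1 := hu _ hy
    have h2 := hv _ hy
    have h3 := huv _ hy
    rw [add_sub_cancel_left] at h1 h2 h3
    rw [inner_sub_left, inner_add_left]
    linarith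
  have hab' : a + a' = b := sub_eq_zero.1 hab
  refine ⟨hab', fun y hy => ?_, fun y hy => ?_⟩ <;>
  · have h1 := hu _ hy
    have h2 := hv _ hy
    have h3 := huv _ hy
    rw [← hab', inner_add_left] at h3
    have h4 : 0 ≤ lam * ‖y - x‖ ^ 2 := by positivity
    have h5 : 0 ≤ C * ‖y - x‖ ^ 2 := by positivity
    rw [abs_le]
    constructor <;> linarith

end QuadraticApproximation

section SecondOrder

variable {V : Type*} [NormedAddCommGroup V] [InnerProductSpace ℝ V]

/-- Points near a Lebesgue density point `x` of `E` are approximated by points of `E`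
within a distance which is small compared to their distance to `x`. -/
theorem eventually_exists_near_of_density [FiniteDimensional ℝ V] [MeasurableSpace V]
    [BorelSpace V] (μ : Measure V) [μ.IsAddHaarMeasure] {E : Set V} {x : V} (hxE : x ∈ E)
    (hx : Tendsto (fun r => μ (E ∩ Metric.closedBall x r) / μ (Metric.closedBall x r))
      (𝓝[>] 0) (𝓝 1)) {s : ℝ} (hs : 0 < s) (hs1 : s ≤ 1) :
    ∀ᶠ y in 𝓝 x, ∃ z ∈ E, ‖z - y‖ ≤ s * ‖y - x‖ := by
  set d := Module.finrank ℝ V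
  set κ : ENNReal := ENNReal.ofReal ((s / 2) ^ d) with hκ
  have hκ0 : κ ≠ 0 := by
    rw [hκ, Ne, ENNReal.ofReal_eq_zero, not_le]; positivity
  have hlt : 1 - κ < 1 := ENNReal.sub_lt_self ENNReal.one_ne_top one_ne_zero hκ0
  have hev := hx.eventually (lt_mem_nhds hlt)
  obtain ⟨ρ, hρ, hρs⟩ := mem_nhdsGT_iff_exists_Ioo_subset.1 hev
  rw [Set.mem_Ioi] at hρ
  filter_upwards [Metric.ball_mem_nhds x (half_pos hρ)] with y hy
  rw [mem_ball_iff_norm] at hy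
  rcases eq_or_ne y x with rfl | hne
  · exact ⟨y, hxE, by simp⟩
  have hpos : 0 < ‖y - x‖ := norm_pos_iff.2 (sub_ne_zero.2 hne)
  set t := 2 * ‖y - x‖ with ht
  have ht0 : 0 < t := by positivity
  have hdens : 1 - κ < μ (E ∩ Metric.closedBall x t) / μ (Metric.closedBall x t) :=
    hρs ⟨ht0, by linarith⟩
  by_contra! hcon
  have hsub : Metric.ball y (s / 2 * t) ⊆ Metric.closedBall x t := by
    intro z hz
    rw [mem_ball_iff_norm] at hz
    rw [mem_closedBall_iff_norm]
    have h1 := norm_add_le (z - y) (y - x)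
    rw [sub_add_sub_cancel] at h1
    nlinarith
  have hE : E ∩ Metric.closedBall x t ⊆ Metric.closedBall x t \ Metric.ball y (s / 2 * t) := by
    rintro z ⟨hzE, hz⟩
    refine ⟨hz, fun hz' => ?_⟩
    rw [mem_ball_iff_norm] at hz'
    have := hcon z hzE
    rw [ht] at hz'
    linarith
  have hball : μ (Metric.ball y (s / 2 * t)) = κ * μ (Metric.closedBall x t) := by
    rw [Measure.addHaar_ball_mul_of_pos μ y (by positivity), hκ,
      Measure.addHaar_closedBall μ x ht0.le, Measure.addHaar_ball_of_pos μ 0 ht0]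
  have hfin : μ (Metric.closedBall x t) ≠ ⊤ := (isCompact_closedBall x t).measure_ne_top
  have h0 : μ (Metric.closedBall x t) ≠ 0 := (Metric.measure_closedBall_pos μ x ht0).ne'
  have hle : μ (E ∩ Metric.closedBall x t) ≤ (1 - κ) * μ (Metric.closedBall x t) := by
    calc μ (E ∩ Metric.closedBall x t)
        ≤ μ (Metric.closedBall x t \ Metric.ball y (s / 2 * t)) := measure_mono hE
      _ = μ (Metric.closedBall x t) - μ (Metric.ball y (s / 2 * t)) :=
          measure_sdiff hsub Metric.isOpen_ball.measurableSet.nullMeasurableSet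
            (measure_mono hsub |>.trans_lt hfin.lt_top).ne
      _ = (1 - κ) * μ (Metric.closedBall x t) := by
          rw [hball, ENNReal.sub_mul (fun _ _ => hfin), one_mul]
  exact (hdens.trans_le (ENNReal.div_le_of_le_mul hle)).false

/-- If `f` is two-sided quadratically approximated with gradients `a` at all points of `E`,
and `a` is differentiable within `E` at a point `x` around which `E` is dense enough, then `f`
has a second-order expansion at `x`. -/
theorem second_order_expansion_of_quadApproxOn {K : ℝ} {S E : Set V} {f : V → ℝ} {a : V → V}
    {x : V} {D : V →L[ℝ] V} (hK : 0 ≤ K) (hS : S ∈ 𝓝 x)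
    (hf : ∀ z ∈ E, QuadApproxOn K S f z (a z)) (hD : HasFDerivWithinAt a D E x)
    (hdens : ∀ s : ℝ, 0 < s → s ≤ 1 → ∀ᶠ y in 𝓝 x, ∃ z ∈ E, ‖z - y‖ ≤ s * ‖y - x‖)
    {ε : ℝ} (hε : 0 < ε) :
    ∀ᶠ y in 𝓝 x, |f y - f x - ⟪a x, y - x⟫ - 1 / 2 * ⟪D (y - x), y - x⟫| ≤
      ε * ‖y - x‖ ^ 2 := by
  obtain ⟨N, hN⟩ := exists_nat_gt (2 * (5 * K + 2 * ‖D‖) / ε)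
  have hN0 : (0 : ℝ) < N := lt_of_le_of_lt (by positivity) hN
  set s : ℝ := (N : ℝ)⁻¹ with hs
  have hs0 : 0 < s := inv_pos.2 hN0
  have hN1 : (1 : ℝ) ≤ N := by exact_mod_cast Nat.pos_of_ne_zero (by rintro rfl; simp at hN0)
  have hs1 : s ≤ 1 := inv_le_one_of_one_le₀ hN1
  have hNs : N * s = 1 := mul_inv_cancel₀ hN0.ne'
  have hsmall : (5 * K + 2 * ‖D‖) * s ≤ ε / 2 := by
    rw [div_lt_iff₀ hε] at hN
    nlinarith
  have hlin : ∀ᶠ z in 𝓝 x, z ∈ E → ‖a z - a x - D (z - x)‖ ≤ ε / 4 * ‖z - x‖ :=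
    eventually_nhdsWithin_iff.1
      ((hasFDerivWithinAt_iff_isLittleO.1 hD).def (by positivity : 0 < ε / 4))
  have hall : ∀ᶠ y in 𝓝 x, y ∈ S ∧ ∃ z ∈ E, ‖z - y‖ ≤ s * ‖y - x‖ :=
    (Filter.eventually_mem_set.2 hS).and (hdens s hs0 hs1)
  obtain ⟨ρ₁, hρ₁, hlin⟩ := Metric.eventually_nhds_iff_ball.1 hlin
  obtain ⟨ρ₂, hρ₂, hall⟩ := Metric.eventually_nhds_iff_ball.1 hall
  filter_upwards [Metric.ball_mem_nhds x (half_pos hρ₁), Metric.ball_mem_nhds x hρ₂] with y hy₁ hy₂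
  rw [mem_ball_iff_norm] at hy₁ hy₂
  set h := y - x with hh
  set q : ℝ → ℝ := fun t => t * ⟪a x, h⟫ + 1 / 2 * t ^ 2 * ⟪D h, h⟫ with hq
  set F : ℝ → ℝ := fun t => f (x + t • h) - q t with hF
  have hmem : ∀ t : ℝ, 0 ≤ t → t ≤ 1 → x + t • h ∈ Metric.ball x ρ₂ := by
    intro t ht0 ht1
    rw [mem_ball_iff_norm, add_sub_cancel_left, norm_smul, Real.norm_of_nonneg ht0]
    exact (mul_le_of_le_one_left (norm_nonneg _) ht1).trans_lt hy₂
  have step : ∀ t : ℝ, 0 ≤ t → t + s ≤ 1 →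
      |F (t + s) - F t| ≤ s * (((5 * K + 2 * ‖D‖) * s + ε / 2) * ‖h‖ ^ 2) := by
    intro t ht0 ht1
    have ht1' : t ≤ 1 := by linarith
    obtain ⟨hPS, z, hzE, hz⟩ := hall _ (hmem t ht0 ht1')
    have hQS := (hall _ (hmem (t + s) (by linarith) ht1)).1
    rw [add_sub_cancel_left, norm_smul, Real.norm_of_nonneg ht0] at hz
    have hth : t * ‖h‖ ≤ ‖h‖ := mul_le_of_le_one_left (norm_nonneg _) ht1'
    have hz1 : ‖z - (x + t • h)‖ ≤ s * ‖h‖ := hz.trans (by gcongr)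
    have hzx : ‖z - x‖ ≤ 2 * ‖h‖ := by
      have h1 := norm_add_le (z - (x + t • h)) (t • h)
      rw [norm_smul, Real.norm_of_nonneg ht0] at h1
      rw [show z - (x + t • h) + t • h = z - x by abel] at h1
      nlinarith [norm_nonneg h]
    have hzlin := hlin z (by rw [mem_ball_iff_norm]; linarith) hzE
    have hzt : ‖a z - a x - t • D h‖ ≤ (ε / 2 + ‖D‖ * s) * ‖h‖ := by
      have h1 : a z - a x - t • D h = (a z - a x - D (z - x)) + D (z - (x + t • h)) := by
        rw [← map_smul, sub_add_eq_sub_sub z, map_sub D (z - x)]; abel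
      rw [h1]
      refine (norm_add_le _ _).trans ?_
      have h2 := (D.le_opNorm (z - (x + t • h))).trans
        (mul_le_mul_of_nonneg_left hz1 (norm_nonneg D))
      nlinarith
    have hzi : |⟪a z - a x - t • D h, h⟫| ≤ (ε / 2 + ‖D‖ * s) * ‖h‖ ^ 2 := by
      refine (abs_real_inner_le_norm _ _).trans ?_
      rw [pow_two, ← mul_assoc]
      gcongr
    have hDi : |⟪D h, h⟫| ≤ ‖D‖ * ‖h‖ ^ 2 := by
      refine (abs_real_inner_le_norm _ _).trans ?_
      rw [pow_two, ← mul_assoc]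
      gcongr
      exact D.le_opNorm h
    have hP := hf z hzE _ hPS
    have hQ := hf z hzE _ hQS
    have hPn : ‖x + t • h - z‖ ≤ s * ‖h‖ := by rw [norm_sub_rev]; exact hz1
    have hQn : ‖x + (t + s) • h - z‖ ≤ 2 * (s * ‖h‖) := by
      have h1 := norm_add_le (x + t • h - z) (s • h)
      rw [norm_smul, Real.norm_of_nonneg hs0.le] at h1
      rw [show x + (t + s) • h - z = x + t • h - z + s • h by rw [add_smul]; abel]
      linarith
    have hPK : K * ‖x + t • h - z‖ ^ 2 ≤ K * (s * ‖h‖) ^ 2 := by gcongr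
    have hQK : K * ‖x + (t + s) • h - z‖ ^ 2 ≤ K * (2 * (s * ‖h‖)) ^ 2 := by gcongr
    have hPa := abs_le.1 (hP.trans hPK)
    have hQa := abs_le.1 (hQ.trans hQK)
    have hQi : ⟪a z, x + (t + s) • h - z⟫ = ⟪a z, x + t • h - z⟫ + s * ⟪a z, h⟫ := by
      rw [show x + (t + s) • h - z = x + t • h - z + s • h by rw [add_smul]; abel,
        inner_add_right, inner_smul_right]
    rw [hQi] at hQa
    rw [inner_sub_left, inner_sub_left, inner_smul_left, RCLike.conj_to_real, abs_le] at hzi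
    rw [abs_le] at hDi
    have hq' : q (t + s) - q t = s * ⟪a x, h⟫ + (t * s + s ^ 2 / 2) * ⟪D h, h⟫ := by
      simp only [hq]; ring
    have hFF : F (t + s) - F t = (f (x + (t + s) • h) - f (x + t • h)) - (q (t + s) - q t) := by
      simp only [hF]; ring
    rw [hFF, hq', abs_le]
    have e1 := mul_le_mul_of_nonneg_left hzi.1 hs0.le
    have e2 := mul_le_mul_of_nonneg_left hzi.2 hs0.le
    have e3 := mul_le_mul_of_nonneg_left hDi.1 (by positivity : 0 ≤ s ^ 2 / 2)
    have e4 := mul_le_mul_of_nonneg_left hDi.2 (by positivity : 0 ≤ s ^ 2 / 2)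
    have e5 : 0 ≤ ‖D‖ * s ^ 2 * ‖h‖ ^ 2 := by positivity
    constructor <;> linarith
  have hsum : ∀ k : ℕ, k ≤ N →
      |F (k * s) - F 0| ≤ k * (s * (((5 * K + 2 * ‖D‖) * s + ε / 2) * ‖h‖ ^ 2)) := by
    intro k
    induction k with
    | zero => simp
    | succ k ih =>
      intro hk
      have hk' : ((k + 1 : ℕ) : ℝ) ≤ N := by exact_mod_cast hk
      push_cast at hk' ⊢
      have hks : (k : ℝ) * s + s ≤ 1 := by
        rw [← hNs]; nlinarith
      have h1 := step (k * s) (by positivity) hks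
      have h2 := abs_add_le (F (k * s + s) - F (k * s)) (F (k * s) - F 0)
      rw [sub_add_sub_cancel] at h2
      rw [add_one_mul (k : ℝ) s, add_one_mul (k : ℝ)]
      linarith [ih (by omega)]
  have hfinal := hsum N le_rfl
  rw [← mul_assoc, hNs, one_mul] at hfinal
  have hF1 : F 1 - F 0 = f y - f x - ⟪a x, h⟫ - 1 / 2 * ⟪D h, h⟫ := by
    simp only [hF, hq, hh]
    simp
    ring
  rw [hF1] at hfinal
  refine hfinal.trans ?_
  gcongr
  linarith

/-- A function with two-sided quadratic approximations at the points of `E` is twice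
differentiable at almost every point of `E`. -/
theorem ae_second_order_expansion [FiniteDimensional ℝ V] [MeasurableSpace V] [BorelSpace V]
    (μ : Measure V) [μ.IsAddHaarMeasure] {K R : ℝ} {x₀ : V} {E : Set V} {f : V → ℝ} {a : V → V}
    (hK : 0 ≤ K) (hE : E ⊆ Metric.ball x₀ (R / 4))
    (hf : ∀ z ∈ E, QuadApproxOn K (Metric.ball x₀ R) f z (a z)) :
    ∀ᵐ x ∂μ, x ∈ E → ∃ D : V →L[ℝ] V, ∀ ε : ℝ, 0 < ε → ∀ᶠ y in 𝓝 x,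
      |f y - f x - ⟪a x, y - x⟫ - 1 / 2 * ⟪D (y - x), y - x⟫| ≤ ε * ‖y - x‖ ^ 2 := by
  have hlip : LipschitzOnWith (6 * K).toNNReal a E := by
    refine LipschitzOnWith.of_dist_le_mul fun x hx y hy => ?_
    rw [Real.coe_toNNReal _ (by positivity), dist_eq_norm, dist_eq_norm]
    exact (hf y hy).norm_gradient_sub_le (hE hy) (hE hx) hK (hf x hx)
  filter_upwards [hlip.ae_differentiableWithinAt_of_mem (μ := μ),
    ae_imp_of_ae_restrict (Besicovitch.ae_tendsto_measure_inter_div μ E)] with x hx₁ hx₂ hxE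
  refine ⟨fderivWithin ℝ a E x, fun ε hε => ?_⟩
  have hxR := hE hxE
  have hS : Metric.ball x₀ R ∈ 𝓝 x := by
    refine Metric.isOpen_ball.mem_nhds ?_
    rw [Metric.mem_ball] at hxR ⊢
    linarith [dist_nonneg (x := x) (y := x₀)]
  exact second_order_expansion_of_quadApproxOn hK hS hf (hx₁ hxE).hasFDerivWithinAt
    (fun s hs hs1 => eventually_exists_near_of_density μ hxE (hx₂ hxE) hs hs1) hε

end SecondOrder

section CommonPoints

variable {V : Type*} [NormedAddCommGroup V] [InnerProductSpace ℝ V]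

/-- A quadratic inequality valid for small vectors is valid for all vectors. -/
theorem inner_le_of_eventually {B : V →L[ℝ] V} {c : ℝ}
    (h : ∀ᶠ y in 𝓝 (0 : V), ⟪B y, y⟫ ≤ c * ‖y‖ ^ 2) (y : V) : ⟪B y, y⟫ ≤ c * ‖y‖ ^ 2 := by
  have ht : Tendsto (fun t : ℝ => t • y) (𝓝[>] 0) (𝓝 0) := by
    have : Tendsto (fun t : ℝ => t • y) (𝓝 0) (𝓝 ((0 : ℝ) • y)) :=
      (continuous_id.smul continuous_const).tendsto 0
    rw [zero_smul] at this
    exact this.mono_left nhdsWithin_le_nhds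
  obtain ⟨t, h1, ht0⟩ := ((ht.eventually h).and self_mem_nhdsWithin).exists
  rw [map_smul, inner_smul_left, inner_smul_right, norm_smul, RCLike.conj_to_real, mul_pow,
    Real.norm_of_nonneg ht0.le] at h1
  have : 0 < t ^ 2 := by positivity
  refine le_of_mul_le_mul_left ?_ this
  linarith

/-- `f` has the second-order expansion with gradient `a` and Hessian form `⟪D h, h⟫` at `x`. -/
def HasSecondOrderExpansion (f : V → ℝ) (x a : V) (D : V →L[ℝ] V) : Prop :=
  ∀ ε : ℝ, 0 < ε → ∀ᶠ y in 𝓝 x,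
    |f y - f x - ⟪a, y - x⟫ - 1 / 2 * ⟪D (y - x), y - x⟫| ≤ ε * ‖y - x‖ ^ 2

theorem HasSecondOrderExpansion.abs_inner_le {f : V → ℝ} {x a : V} {D : V →L[ℝ] V} {K : ℝ}
    {S : Set V} (hS : S ∈ 𝓝 x) (h : HasSecondOrderExpansion f x a D)
    (hf : QuadApproxOn K S f x a) (y : V) : |⟪D y, y⟫| ≤ 2 * (K + 1) * ‖y‖ ^ 2 := by
  have hev : ∀ᶠ y in 𝓝 (0 : V), |⟪D y, y⟫| ≤ 2 * (K + 1) * ‖y‖ ^ 2 := by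
    filter_upwards [(tendsto_const_add_nhds_zero x).eventually (h 1 one_pos),
      (tendsto_const_add_nhds_zero x).eventually hS] with y hy hyS
    have h1 := hf _ hyS
    rw [add_sub_cancel_left] at h1 hy
    rw [abs_le] at *
    constructor <;> linarith
  rw [abs_le, neg_le]
  constructor
  · have := inner_le_of_eventually (B := -D) (c := 2 * (K + 1)) (hev.mono fun z hz => by
      simpa using (neg_le_abs _).trans hz) y
    simpa using this
  · exact inner_le_of_eventually (hev.mono fun z hz => (le_abs_self _).trans hz) y

theorem HasSecondOrderExpansion.inner_add_le {u v : V → ℝ} {x a a' : V} {D D' T : V →L[ℝ] V}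
    {c : ℝ} (hu : HasSecondOrderExpansion u x a D) (hv : HasSecondOrderExpansion v x a' D')
    (huv : ∀ᶠ y in 𝓝 x, u y + v y ≤ u x + v x + ⟪a + a', y - x⟫
      + (1 / 2 * ⟪T (y - x), y - x⟫ + c * ‖y - x‖ ^ 2)) (h : V) :
    ⟪D h, h⟫ + ⟪D' h, h⟫ ≤ ⟪T h, h⟫ + 2 * c * ‖h‖ ^ 2 := by
  have key : ∀ η : ℝ, 0 < η → ⟪(D + D' - T) h, h⟫ ≤ (2 * c + 4 * η) * ‖h‖ ^ 2 := by
    intro η hη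
    refine inner_le_of_eventually ?_ h
    have ht := tendsto_const_add_nhds_zero x
    filter_upwards [ht.eventually (hu η hη), ht.eventually (hv η hη), ht.eventually huv]
      with y h1 h2 h3
    rw [add_sub_cancel_left] at h1 h2 h3
    rw [inner_add_left] at h3
    rw [abs_le] at h1 h2
    simp only [sub_apply, add_apply, inner_sub_left,
      inner_add_left]
    linarith
  have ht : Tendsto (fun η : ℝ => (2 * c + 4 * η) * ‖h‖ ^ 2) (𝓝[>] 0)
      (𝓝 ((2 * c + 4 * 0) * ‖h‖ ^ 2)) :=
    Tendsto.mono_left (Continuous.tendsto (by fun_prop) _) nhdsWithin_le_nhds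
  have h1 := ge_of_tendsto ht (by filter_upwards [self_mem_nhdsWithin] with η hη using key η hη)
  simp only [sub_apply, add_apply, inner_sub_left,
    inner_add_left] at h1
  linarith

/-- Each small linear perturbation of a strict quadratic contact is realised as a quadratic
contact at a nearby point. -/
theorem exists_contact_of_perturbation [FiniteDimensional ℝ V] {w : V → ℝ} {x₀ p₀ p : V}
    {R ε ρ : ℝ} (hR : 0 ≤ R) (hw : ContinuousOn w (Metric.closedBall x₀ R)) {T : V →L[ℝ] V}
    (hT : ∀ y z, ⟪T y, z⟫ = ⟪y, T z⟫) (hε : 0 < ε) (hρ : 0 < ρ) (hp : ‖p‖ < ε * ρ)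
    (hcontact : ∀ y ∈ Metric.closedBall x₀ R,
      w y ≤ w x₀ + ⟪p₀, y - x₀⟫ + 1 / 2 * ⟪T (y - x₀), y - x₀⟫) :
    ∃ x ∈ Metric.ball x₀ ρ, ∀ y ∈ Metric.closedBall x₀ R,
      w y ≤ w x + ⟪p + p₀ + T (x - x₀) + (2 * ε) • (x - x₀), y - x⟫
        + (1 / 2 * ⟪T (y - x), y - x⟫ + ε * ‖y - x‖ ^ 2) := by
  set g : V → ℝ := fun y => w y - ⟪p + p₀, y - x₀⟫ - 1 / 2 * ⟪T (y - x₀), y - x₀⟫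
    - ε * ‖y - x₀‖ ^ 2 with hg
  have hgc : ContinuousOn g (Metric.closedBall x₀ R) := by
    refine ((hw.sub ?_).sub ?_).sub ?_ <;> exact Continuous.continuousOn (by fun_prop)
  obtain ⟨x, hx, hmax⟩ := (isCompact_closedBall x₀ R).exists_isMaxOn
    ⟨x₀, Metric.mem_closedBall_self hR⟩ hgc
  refine ⟨x, ?_, fun y hy => ?_⟩
  · have h1 : g x₀ ≤ g x := hmax (Metric.mem_closedBall_self hR)
    have h2 := hcontact x hx
    have h3 := (neg_le_abs _).trans (abs_real_inner_le_norm p (x - x₀))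
    simp only [hg, sub_self, inner_zero_right, map_zero, norm_zero, inner_add_left] at h1
    rw [mem_ball_iff_norm]
    by_contra! hcon
    have h4 : ε * ‖x - x₀‖ * ‖x - x₀‖ ≤ ‖p‖ * ‖x - x₀‖ := by nlinarith
    have h5 := le_of_mul_le_mul_right h4 (hρ.trans_le hcon)
    have h6 : ε * ρ ≤ ε * ‖x - x₀‖ := by gcongr
    linarith
  · have h1 : g y ≤ g x := hmax hy
    simp only [hg] at h1
    have hyx : y - x₀ = (x - x₀) + (y - x) := by abel
    have e1 : ⟪p + p₀, y - x₀⟫ = ⟪p + p₀, x - x₀⟫ + ⟪p + p₀, y - x⟫ := by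
      rw [hyx, inner_add_right]
    have e2 : ⟪T (y - x₀), y - x₀⟫ = ⟪T (x - x₀), x - x₀⟫ + 2 * ⟪T (x - x₀), y - x⟫
        + ⟪T (y - x), y - x⟫ := by
      rw [hyx, map_add, inner_add_left, inner_add_right, inner_add_right, hT (y - x) (x - x₀),
        real_inner_comm _ (y - x)]
      ring
    have e3 : ‖y - x₀‖ ^ 2 = ‖x - x₀‖ ^ 2 + 2 * ⟪x - x₀, y - x⟫ + ‖y - x‖ ^ 2 := by
      rw [hyx, norm_add_sq_real]
    rw [e1, e2, e3] at h1
    have e4 : ⟪p + p₀ + T (x - x₀) + (2 * ε) • (x - x₀), y - x⟫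
        = ⟪p + p₀, y - x⟫ + ⟪T (x - x₀), y - x⟫ + 2 * ε * ⟪x - x₀, y - x⟫ := by
      rw [inner_add_left, inner_add_left, inner_smul_left, RCLike.conj_to_real]
    rw [e4]
    linarith

theorem inner_add_sq_le {T : V →L[ℝ] V} {ε : ℝ} (hε : ε ≤ 1) (h : V) :
    1 / 2 * ⟪T h, h⟫ + ε * ‖h‖ ^ 2 ≤ (‖T‖ / 2 + 1) * ‖h‖ ^ 2 := by
  have h1 := (real_inner_le_norm (T h) h).trans
    (mul_le_mul_of_nonneg_right (T.le_opNorm h) (norm_nonneg h))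
  nlinarith [sq_nonneg ‖h‖]

/-- Near an upper quadratic contact point of `u + v`, with `u` and `v` semiconvex, there are
points at which both `u` and `v` have second-order expansions, with controlled Hessians. -/
theorem exists_common_second_order_expansion [FiniteDimensional ℝ V] {u v : V → ℝ} {x₀ p₀ : V}
    {R lam ε : ℝ} (hR : 0 < R) (hlam : 0 ≤ lam)
    (huv : ContinuousOn (fun y => u y + v y) (Metric.closedBall x₀ R)) {T : V →L[ℝ] V}
    (hT : ∀ y z, ⟪T y, z⟫ = ⟪y, T z⟫)
    (hu : ∀ x ∈ Metric.ball x₀ R, ∃ a : V, ∀ y ∈ Metric.ball x₀ R,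
      u x + ⟪a, y - x⟫ - lam / 2 * ‖y - x‖ ^ 2 ≤ u y)
    (hv : ∀ x ∈ Metric.ball x₀ R, ∃ a : V, ∀ y ∈ Metric.ball x₀ R,
      v x + ⟪a, y - x⟫ - lam / 2 * ‖y - x‖ ^ 2 ≤ v y)
    (hcontact : ∀ y ∈ Metric.closedBall x₀ R,
      u y + v y ≤ u x₀ + v x₀ + ⟪p₀, y - x₀⟫ + 1 / 2 * ⟪T (y - x₀), y - x₀⟫)
    (hε : 0 < ε) (hε1 : ε ≤ 1) :
    ∃ (x a a' : V) (D D' : V →L[ℝ] V), x ∈ Metric.ball x₀ ε ∧ x ∈ Metric.ball x₀ (R / 4) ∧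
      QuadApproxOn (‖T‖ / 2 + 1 + lam) (Metric.ball x₀ R) u x a ∧
      QuadApproxOn (‖T‖ / 2 + 1 + lam) (Metric.ball x₀ R) v x a' ∧
      HasSecondOrderExpansion u x a D ∧ HasSecondOrderExpansion v x a' D' ∧
      ∀ h, ⟪D h, h⟫ + ⟪D' h, h⟫ ≤ ⟪T h, h⟫ + 2 * ε * ‖h‖ ^ 2 := by
  borelize V
  set K := ‖T‖ / 2 + 1 + lam with hK
  have hK0 : 0 ≤ K := by positivity
  set ρ := min ε (R / 4) with hρ
  have hρ0 : 0 < ρ := by positivity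
  have hρR : Metric.ball x₀ ρ ⊆ Metric.ball x₀ (R / 4) :=
    Metric.ball_subset_ball (min_le_right _ _)
  have hRR : Metric.ball x₀ (R / 4) ⊆ Metric.ball x₀ R :=
    Metric.ball_subset_ball (by linarith)
  let G : V → V → V → Prop := fun x a a' =>
    QuadApproxOn K (Metric.ball x₀ R) u x a ∧ QuadApproxOn K (Metric.ball x₀ R) v x a' ∧
    ∀ y ∈ Metric.ball x₀ R, u y + v y ≤ u x + v x + ⟪a + a', y - x⟫
      + (1 / 2 * ⟪T (y - x), y - x⟫ + ε * ‖y - x‖ ^ 2)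
  have hcov : ∀ p ∈ Metric.ball (0 : V) (ε * ρ), ∃ x ∈ Metric.ball x₀ ρ, ∃ a a', G x a a' ∧
      a + a' = p + p₀ + T (x - x₀) + (2 * ε) • (x - x₀) := by
    intro p hp
    rw [mem_ball_zero_iff] at hp
    obtain ⟨x, hx, hxc⟩ := exists_contact_of_perturbation hR.le huv hT hε hρ0 hp hcontact
    have hxR := hRR (hρR hx)
    obtain ⟨a, ha⟩ := hu x hxR
    obtain ⟨a', ha'⟩ := hv x hxR
    obtain ⟨h1, h2, h3⟩ := exists_quadApproxOn_of_add_le Metric.isOpen_ball hlam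
      (C := ‖T‖ / 2 + 1) (by positivity) hxR ha ha' fun y hy =>
        (hxc y (Metric.ball_subset_closedBall hy)).trans
          (by gcongr; exact inner_add_sq_le hε1 _)
    refine ⟨x, hx, a, a', ⟨h2, h3, fun y hy => ?_⟩, h1⟩
    rw [h1]
    exact hxc y (Metric.ball_subset_closedBall hy)
  set E : Set V := {x | x ∈ Metric.ball x₀ ρ ∧ ∃ a a', G x a a'} with hE
  have hEsub : E ⊆ Metric.ball x₀ (R / 4) := fun x hx => hρR hx.1
  choose! α α' hα using fun x (hx : x ∈ E) => hx.2
  have hlip : LipschitzOnWith (12 * K + ‖T‖ + 2 * ε).toNNReal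
      (fun x => α x + α' x - p₀ - T (x - x₀) - (2 * ε) • (x - x₀)) E := by
    refine LipschitzOnWith.of_dist_le_mul fun x hx y hy => ?_
    rw [Real.coe_toNNReal _ (by positivity), dist_eq_norm, dist_eq_norm]
    have h1 := (hα y hy).1.norm_gradient_sub_le (hEsub hy) (hEsub hx) hK0 (hα x hx).1
    have h2 := (hα y hy).2.1.norm_gradient_sub_le (hEsub hy) (hEsub hx) hK0 (hα x hx).2.1
    have h3 := T.le_opNorm (x - y)
    have h4 : ‖(2 * ε) • (x - y)‖ = 2 * ε * ‖x - y‖ := by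
      rw [norm_smul, Real.norm_of_nonneg (by positivity)]
    have h5 : α x + α' x - p₀ - T (x - x₀) - (2 * ε) • (x - x₀)
        - (α y + α' y - p₀ - T (y - x₀) - (2 * ε) • (y - x₀))
        = (α x - α y) + (α' x - α' y) - T (x - y) - (2 * ε) • (x - y) := by
      simp only [map_sub, smul_sub]; abel
    rw [h5]
    have h6 := norm_sub_le ((α x - α y) + (α' x - α' y) - T (x - y)) ((2 * ε) • (x - y))
    have h7 := norm_sub_le ((α x - α y) + (α' x - α' y)) (T (x - y))
    have h8 := norm_add_le (α x - α y) (α' x - α' y)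
    linarith
  have himage : Metric.ball (0 : V) (ε * ρ) ⊆
      (fun x => α x + α' x - p₀ - T (x - x₀) - (2 * ε) • (x - x₀)) '' E := by
    intro p hp
    obtain ⟨x, hx, a, a', hG, hsum⟩ := hcov p hp
    have hxE : x ∈ E := ⟨hx, a, a', hG⟩
    refine ⟨x, hxE, ?_⟩
    have h1 := hG.1.norm_gradient_sub_le (hEsub hxE) (hEsub hxE) hK0 (hα x hxE).1
    have h2 := hG.2.1.norm_gradient_sub_le (hEsub hxE) (hEsub hxE) hK0 (hα x hxE).2.1
    rw [sub_self, norm_zero, mul_zero, norm_le_zero_iff, sub_eq_zero] at h1 h2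
    simp only [h1, h2, hsum]
    abel
  let μ : Measure V := μH[Module.finrank ℝ V]
  have hμE : μ E ≠ 0 := by
    intro h0
    have h1 := hlip.hausdorffMeasure_image_le (d := Module.finrank ℝ V) (by positivity)
    have h2 : μ (Metric.ball (0 : V) (ε * ρ)) ≤ 0 := by
      refine (measure_mono himage).trans (h1.trans ?_)
      rw [show μH[Module.finrank ℝ V] E = 0 from h0, mul_zero]
    exact (Metric.measure_ball_pos μ (0 : V) (by positivity : 0 < ε * ρ)).not_ge h2
  have hgood : ∃ x ∈ E, (∃ D, HasSecondOrderExpansion u x (α x) D) ∧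
      ∃ D', HasSecondOrderExpansion v x (α' x) D' := by
    by_contra! hcon
    have h1 := ae_second_order_expansion μ hK0 hEsub fun z hz => (hα z hz).1
    have h2 := ae_second_order_expansion μ hK0 hEsub fun z hz => (hα z hz).2.1
    apply hμE
    refine measure_mono_null (fun x hx => ?_) (h1.and h2)
    intro h3
    obtain ⟨D', hD'⟩ := h3.2 hx
    exact hcon x hx (h3.1 hx) D' hD'
  obtain ⟨x, hxE, ⟨D, hD⟩, D', hD'⟩ := hgood
  refine ⟨x, α x, α' x, D, D', Metric.ball_subset_ball (min_le_left _ _) hxE.1, hEsub hxE,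
    (hα x hxE).1, (hα x hxE).2.1, hD, hD', hD.inner_add_le hD' ?_⟩
  filter_upwards [Metric.isOpen_ball.mem_nhds (hRR (hEsub hxE))] with y hy
  exact (hα x hxE).2.2 y hy

end CommonPoints

section QuadraticForms

variable {n : ℕ}

theorem quad_eq_inner (A : Matrix (Fin n) (Fin n) ℝ) (v : EuclideanSpace ℝ (Fin n)) :
    quad A v = ⟪Matrix.toEuclideanCLM (𝕜 := ℝ) A v, v⟫ := by
  rw [real_inner_comm, Matrix.inner_toEuclideanCLM]
  simp only [quad, dotProduct, Matrix.mulVec, Finset.mul_sum]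
  exact Finset.sum_congr rfl fun i _ => Finset.sum_congr rfl fun j _ => by ring

theorem quad_add (A B : Matrix (Fin n) (Fin n) ℝ) (v : EuclideanSpace ℝ (Fin n)) :
    quad (A + B) v = quad A v + quad B v := by
  simp only [quad, Matrix.add_apply, add_mul, Finset.sum_add_distrib]

theorem quad_smul (c : ℝ) (A : Matrix (Fin n) (Fin n) ℝ) (v : EuclideanSpace ℝ (Fin n)) :
    quad (c • A) v = c * quad A v := by
  simp only [quad, Matrix.smul_apply, smul_eq_mul, Finset.mul_sum, mul_assoc]

theorem quad_transpose (A : Matrix (Fin n) (Fin n) ℝ) (v : EuclideanSpace ℝ (Fin n)) :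
    quad A.transpose v = quad A v := by
  simp only [quad, Matrix.transpose_apply]
  rw [Finset.sum_comm]
  exact Finset.sum_congr rfl fun i _ => Finset.sum_congr rfl fun j _ => by ring

theorem quad_one (v : EuclideanSpace ℝ (Fin n)) :
    quad (1 : Matrix (Fin n) (Fin n) ℝ) v = ‖v‖ ^ 2 := by
  rw [quad_eq_inner, map_one, one_apply_eq_self, real_inner_self_eq_norm_sq]

theorem continuous_quad (v : EuclideanSpace ℝ (Fin n)) :
    Continuous fun A : Matrix (Fin n) (Fin n) ℝ => quad A v := by
  unfold quad
  fun_prop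

theorem exists_isSymm_quad_eq
    (D : EuclideanSpace ℝ (Fin n) →L[ℝ] EuclideanSpace ℝ (Fin n)) :
    ∃ H : Matrix (Fin n) (Fin n) ℝ, H.IsSymm ∧ ∀ v, quad H v = ⟪D v, v⟫ := by
  set M := (Matrix.toEuclideanCLM (n := Fin n) (𝕜 := ℝ)).symm D with hM
  refine ⟨(1 / 2 : ℝ) • (M + M.transpose), (Matrix.isSymm_add_transpose_self M).smul _,
    fun v => ?_⟩
  rw [quad_smul, quad_add, quad_transpose, quad_eq_inner, hM, StarAlgEquiv.apply_symm_apply]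
  ring

theorem inner_toEuclideanCLM_comm {A : Matrix (Fin n) (Fin n) ℝ} (hA : A.IsSymm)
    (y z : EuclideanSpace ℝ (Fin n)) :
    ⟪Matrix.toEuclideanCLM (𝕜 := ℝ) A y, z⟫ = ⟪y, Matrix.toEuclideanCLM (𝕜 := ℝ) A z⟫ := by
  rw [real_inner_comm, Matrix.inner_toEuclideanCLM, Matrix.inner_toEuclideanCLM,
    Matrix.dotProduct_mulVec, ← Matrix.mulVec_transpose, hA.eq, dotProduct_comm]

theorem Matrix.IsSymm.abs_apply_le_of_quad {H : Matrix (Fin n) (Fin n) ℝ} (hH : H.IsSymm) {M : ℝ}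
    (hM : ∀ v, |quad H v| ≤ M * ‖v‖ ^ 2) (i j : Fin n) : |H i j| ≤ M := by
  set L := Matrix.toEuclideanCLM (n := Fin n) (𝕜 := ℝ) H
  set a : EuclideanSpace ℝ (Fin n) := EuclideanSpace.single i 1
  set b : EuclideanSpace ℝ (Fin n) := EuclideanSpace.single j 1
  have hab : ⟪a, L b⟫ = H i j := by
    rw [Matrix.inner_toEuclideanCLM]; simp [a, b]
  have hcomm : ⟪L a, b⟫ = ⟪a, L b⟫ := inner_toEuclideanCLM_comm hH a b
  have hna : ‖a‖ = 1 := by simp [a]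
  have hnb : ‖b‖ = 1 := by simp [b]
  have h1 := abs_le.1 (hM (a + b))
  have h2 := abs_le.1 (hM (a - b))
  have hpar := parallelogram_law_with_norm ℝ a b
  rw [hna, hnb] at hpar
  rw [quad_eq_inner] at h1 h2
  have e1 : ⟪L (a + b), a + b⟫ - ⟪L (a - b), a - b⟫ = 4 * H i j := by
    rw [← hab]
    simp only [map_add, map_sub, inner_add_left, inner_add_right, inner_sub_left, inner_sub_right]
    rw [hcomm, real_inner_comm (L b) a]
    ring
  have e2 : M * ‖a + b‖ ^ 2 + M * ‖a - b‖ ^ 2 = 4 * M := by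
    linear_combination M * hpar
  rw [abs_le]
  constructor <;> linarith

theorem HasSecondOrderExpansion.upperContactJet {f : EuclideanSpace ℝ (Fin n) → ℝ}
    {x a : EuclideanSpace ℝ (Fin n)} {D : EuclideanSpace ℝ (Fin n) →L[ℝ] EuclideanSpace ℝ (Fin n)}
    {A : Matrix (Fin n) (Fin n) ℝ} {ε : ℝ} (hε : 0 < ε) (hf : HasSecondOrderExpansion f x a D)
    (hA : ∀ v, ⟪D v, v⟫ + 2 * ε * ‖v‖ ^ 2 ≤ quad A v) : UpperContactJet f x a A := by
  filter_upwards [hf ε hε] with y hy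
  have h1 := (abs_le.1 hy).2
  have h2 := hA (y - x)
  linarith

theorem tendsto_subseq_of_abs_apply_le {H : ℕ → Matrix (Fin n) (Fin n) ℝ} {M : ℝ}
    (hH : ∀ k i j, |H k i j| ≤ M) :
    ∃ (A : Matrix (Fin n) (Fin n) ℝ) (φ : ℕ → ℕ), StrictMono φ ∧
      Tendsto (H ∘ φ) atTop (𝓝 A) := by
  have hc : IsCompact (Set.univ.pi fun _ : Fin n => Set.univ.pi fun _ : Fin n => Set.Icc (-M) M) :=
    isCompact_univ_pi fun _ => isCompact_univ_pi fun _ => isCompact_Icc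
  obtain ⟨A, -, φ, hφ, hA⟩ := hc.tendsto_subseq (X := Fin n → Fin n → ℝ) (x := H)
    fun k i _ j _ => abs_le.1 (hH k i j)
  exact ⟨A, φ, hφ, hA⟩

theorem QCOn.exists_lower_paraboloid {lam : ℝ} {U : Set (EuclideanSpace ℝ (Fin n))}
    (hU : IsOpen U) {w : EuclideanSpace ℝ (Fin n) → ℝ} (hw : QCOn lam U w)
    {x : EuclideanSpace ℝ (Fin n)} (hx : x ∈ U) :
    ∃ a : EuclideanSpace ℝ (Fin n), ∀ y ∈ U, w x + ⟪a, y - x⟫ - lam / 2 * ‖y - x‖ ^ 2 ≤ w y :=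
  _root_.exists_lower_paraboloid hU hw hx

theorem QCOn.continuousOn {lam : ℝ} {U : Set (EuclideanSpace ℝ (Fin n))} (hU : IsOpen U)
    {w : EuclideanSpace ℝ (Fin n) → ℝ} (hw : QCOn lam U w) : ContinuousOn w U := by
  have h1 := (ConvexOn.continuousOn hU hw).sub
    (Continuous.continuousOn (by fun_prop : Continuous fun x => lam / 2 * ‖x‖ ^ 2))
  exact h1.congr fun y _ => by simp

/-- Limits of second-order expansions, with the Hessian enlarged by a nonnegative form, lie in
the closure of the upper contact jets. -/
theorem mem_closure_upperContactJet {f : EuclideanSpace ℝ (Fin n) → ℝ}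
    {x₀ a₀ : EuclideanSpace ℝ (Fin n)} {x a : ℕ → EuclideanSpace ℝ (Fin n)}
    {D : ℕ → EuclideanSpace ℝ (Fin n) →L[ℝ] EuclideanSpace ℝ (Fin n)}
    {H : ℕ → Matrix (Fin n) (Fin n) ℝ} {A P : Matrix (Fin n) (Fin n) ℝ}
    (hfx : ContinuousAt f x₀) (hx : Tendsto x atTop (𝓝 x₀)) (ha : Tendsto a atTop (𝓝 a₀))
    (hH : Tendsto H atTop (𝓝 A)) (hD : ∀ k, HasSecondOrderExpansion f (x k) (a k) (D k))
    (hHs : ∀ k, (H k).IsSymm) (hHq : ∀ k v, quad (H k) v = ⟪D k v, v⟫) (hPs : P.IsSymm)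
    (hP : ∀ v, 0 ≤ quad P v) :
    (x₀, f x₀, a₀, A + P) ∈ closure {z : Jet n |
      z.2.1 = f z.1 ∧ z.2.2.2.IsSymm ∧ UpperContactJet f z.1 z.2.2.1 z.2.2.2} := by
  set ε : ℕ → ℝ := fun k => 1 / ((k : ℝ) + 1) with hε
  have hε0 : ∀ k, 0 < ε k := fun k => Nat.one_div_pos_of_nat
  have hεt : Tendsto ε atTop (𝓝 0) := tendsto_one_div_add_atTop_nhds_zero_nat
  have hmat : Tendsto (fun k => H k + (2 * ε k) • (1 : Matrix (Fin n) (Fin n) ℝ) + P) atTop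
      (𝓝 (A + P)) := by
    have := (hH.add ((hεt.const_mul 2).smul_const (1 : Matrix (Fin n) (Fin n) ℝ))).add_const P
    simpa using this
  refine mem_closure_of_tendsto (hx.prodMk_nhds ((hfx.tendsto.comp hx).prodMk_nhds
    (ha.prodMk_nhds hmat))) (Eventually.of_forall fun k => ⟨rfl, ?_, ?_⟩)
  · exact ((hHs k).add ((Matrix.isSymm_one).smul _)).add hPs
  · refine (hD k).upperContactJet (hε0 k) fun v => ?_
    simp only [quad_add, quad_smul, quad_one, hHq]
    linarith [hP v]

end QuadraticForms

/-- Given an upper contact jet `(p₀, A₀)` for `w = u + v` at `x₀`, with `u, v` quasi-convex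
near `x₀`, there are jets `(p, A') ∈ closure J⁺(u)` and `(q, B) ∈ closure J⁺(v)` at `x₀`
with values `u(x₀)`, `v(x₀)`, such that `p + q = p₀` and `A' + B = A₀`. -/
theorem stmt_18 {n : ℕ} (x₀ : EuclideanSpace ℝ (Fin n)) (r : ℝ) (hr : 0 < r)
    (u v : EuclideanSpace ℝ (Fin n) → ℝ) (lam : ℝ) (hlam : 0 ≤ lam)
    (hqcu : QCOn lam (Metric.ball x₀ r) u) (hqcv : QCOn lam (Metric.ball x₀ r) v)
    (p₀ : EuclideanSpace ℝ (Fin n)) (A₀ : Matrix (Fin n) (Fin n) ℝ) (hA₀ : A₀.IsSymm)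
    (hjet : UpperContactJet (fun y => u y + v y) x₀ p₀ A₀) :
    ∃ (p q : EuclideanSpace ℝ (Fin n)) (A' B : Matrix (Fin n) (Fin n) ℝ),
      (x₀, u x₀, p, A') ∈ closure {z : Jet n |
        z.2.1 = u z.1 ∧ z.2.2.2.IsSymm ∧ UpperContactJet u z.1 z.2.2.1 z.2.2.2} ∧
      (x₀, v x₀, q, B) ∈ closure {z : Jet n |
        z.2.1 = v z.1 ∧ z.2.2.2.IsSymm ∧ UpperContactJet v z.1 z.2.2.1 z.2.2.2} ∧
      p + q = p₀ ∧ A' + B = A₀ := by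
  set T := Matrix.toEuclideanCLM (n := Fin n) (𝕜 := ℝ) A₀ with hTdef
  obtain ⟨ρ, hρ, hcon⟩ := Metric.eventually_nhds_iff_ball.1 hjet
  set R := min ρ r / 2 with hRdef
  have hR : 0 < R := by positivity
  have hRρ : R < ρ := by
    have := min_le_left ρ r
    have := lt_min hρ hr
    linarith
  have hRr : R < r := by
    have := min_le_right ρ r
    have := lt_min hρ hr
    linarith
  have hsub : Metric.ball x₀ R ⊆ Metric.ball x₀ r := Metric.ball_subset_ball hRr.le
  have hcontact : ∀ y ∈ Metric.closedBall x₀ R,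
      u y + v y ≤ u x₀ + v x₀ + ⟪p₀, y - x₀⟫ + 1 / 2 * ⟪T (y - x₀), y - x₀⟫ := by
    intro y hy
    rw [hTdef, ← quad_eq_inner]
    exact hcon y (Metric.closedBall_subset_ball hRρ hy)
  have huc := hqcu.continuousOn Metric.isOpen_ball
  have hvc := hqcv.continuousOn Metric.isOpen_ball
  have hlow : ∀ w, QCOn lam (Metric.ball x₀ r) w → ∀ x ∈ Metric.ball x₀ R,
      ∃ a : EuclideanSpace ℝ (Fin n), ∀ y ∈ Metric.ball x₀ R,
        w x + ⟪a, y - x⟫ - lam / 2 * ‖y - x‖ ^ 2 ≤ w y := by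
    intro w hw x hx
    obtain ⟨a, ha⟩ := hw.exists_lower_paraboloid Metric.isOpen_ball (hsub hx)
    exact ⟨a, fun y hy => ha y (hsub hy)⟩
  have hx₀ : x₀ ∈ Metric.ball x₀ R := Metric.mem_ball_self hR
  have hx₀' : x₀ ∈ Metric.ball x₀ (R / 4) := Metric.mem_ball_self (by positivity)
  obtain ⟨p, hp⟩ := hlow u hqcu x₀ hx₀
  obtain ⟨q, hq⟩ := hlow v hqcv x₀ hx₀
  obtain ⟨hpq, hpu, hqv⟩ := exists_quadApproxOn_of_add_le Metric.isOpen_ball hlam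
    (b := p₀) (C := ‖T‖ / 2 + 1) (by positivity) hx₀ hp hq fun y hy => by
      have h1 := hcontact y (Metric.ball_subset_closedBall hy)
      have h2 := inner_add_sq_le (T := T) zero_le_one (y - x₀)
      linarith
  have hpts := fun k : ℕ => exists_common_second_order_expansion hR hlam
    ((huc.add hvc).mono (Metric.closedBall_subset_ball hRr)) (inner_toEuclideanCLM_comm hA₀)
    (hlow u hqcu) (hlow v hqcv) hcontact (ε := 1 / ((k : ℝ) + 1)) Nat.one_div_pos_of_nat
    (by rw [div_le_one (by positivity)]; linarith [Nat.cast_nonneg (α := ℝ) k])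
  choose x a a' D D' hxk hxR hau hav hD hD' hDD using hpts
  choose H hHs hHq using fun k => exists_isSymm_quad_eq (D k)
  choose H' hHs' hHq' using fun k => exists_isSymm_quad_eq (D' k)
  set K := ‖T‖ / 2 + 1 + lam with hK
  have hK0 : 0 ≤ K := by positivity
  have hnhds : ∀ k, Metric.ball x₀ R ∈ 𝓝 (x k) := fun k =>
    Metric.isOpen_ball.mem_nhds (Metric.ball_subset_ball (by linarith) (hxR k))
  have hεt : Tendsto (fun k : ℕ => 1 / ((k : ℝ) + 1)) atTop (𝓝 0) :=
    tendsto_one_div_add_atTop_nhds_zero_nat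
  have hxt : Tendsto x atTop (𝓝 x₀) := by
    rw [tendsto_iff_dist_tendsto_zero]
    exact squeeze_zero (fun _ => dist_nonneg) (fun k => (Metric.mem_ball.1 (hxk k)).le) hεt
  have hgrad : ∀ {b : ℕ → EuclideanSpace ℝ (Fin n)} {b₀ : EuclideanSpace ℝ (Fin n)},
      (∀ k, ‖b k - b₀‖ ≤ 6 * K * ‖x k - x₀‖) → Tendsto b atTop (𝓝 b₀) := by
    intro b b₀ hb
    rw [tendsto_iff_norm_sub_tendsto_zero] at hxt ⊢
    exact squeeze_zero (fun _ => norm_nonneg _) hb (by simpa using hxt.const_mul (6 * K))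
  have hat : Tendsto a atTop (𝓝 p) := hgrad fun k =>
    hpu.norm_gradient_sub_le hx₀' (hxR k) hK0 (hau k)
  have hat' : Tendsto a' atTop (𝓝 q) := hgrad fun k =>
    hqv.norm_gradient_sub_le hx₀' (hxR k) hK0 (hav k)
  obtain ⟨A, φ, hφ, hA⟩ := tendsto_subseq_of_abs_apply_le (H := H) fun k =>
    (hHs k).abs_apply_le_of_quad fun z => by
      rw [hHq]; exact (hD k).abs_inner_le (hnhds k) (hau k) z
  obtain ⟨B, ψ, hψ, hB⟩ := tendsto_subseq_of_abs_apply_le (H := H' ∘ φ) fun k =>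
    (hHs' (φ k)).abs_apply_le_of_quad fun z => by
      rw [hHq']; exact (hD' (φ k)).abs_inner_le (hnhds (φ k)) (hav (φ k)) z
  have hχ : Tendsto (φ ∘ ψ) atTop atTop := (hφ.comp hψ).tendsto_atTop
  have hA' : Tendsto (H ∘ (φ ∘ ψ)) atTop (𝓝 A) := hA.comp hψ.tendsto_atTop
  have hsymm : ∀ {M : Matrix (Fin n) (Fin n) ℝ} {G : ℕ → Matrix (Fin n) (Fin n) ℝ},
      (∀ k, (G k).IsSymm) → Tendsto G atTop (𝓝 M) → M.IsSymm := by
    intro M G hG hGM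
    have h1 : Tendsto (fun k => (G k).transpose) atTop (𝓝 M.transpose) :=
      (continuous_id.matrix_transpose.tendsto M).comp hGM
    exact tendsto_nhds_unique h1 (hGM.congr fun k => (hG k).eq.symm)
  have hAB : ∀ z, 0 ≤ quad (A₀ - A - B) z := by
    intro z
    have h1 : Tendsto (fun k => quad (H (φ (ψ k))) z + quad (H' (φ (ψ k))) z) atTop
        (𝓝 (quad A z + quad B z)) :=
      (((continuous_quad z).tendsto A).comp hA').add (((continuous_quad z).tendsto B).comp hB)
    have h2 : Tendsto (fun k => quad A₀ z + 2 * (1 / (((φ ∘ ψ) k : ℕ) + 1 : ℝ)) * ‖z‖ ^ 2) atTop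
        (𝓝 (quad A₀ z + 2 * 0 * ‖z‖ ^ 2)) :=
      (((hεt.comp hχ).const_mul 2).mul_const _).const_add _
    have h3 : quad A z + quad B z ≤ quad A₀ z + 2 * 0 * ‖z‖ ^ 2 :=
      le_of_tendsto_of_tendsto' h1 h2 fun k => by
        rw [hHq, hHq', quad_eq_inner]
        exact hDD (φ (ψ k)) z
    have h4 : quad (A₀ - A - B) z + quad A z + quad B z = quad A₀ z := by
      rw [← quad_add, ← quad_add]; congr 1; abel
    linarith
  have hAs := hsymm (fun k => hHs _) hA'
  have hBs := hsymm (fun k => hHs' _) hB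
  refine ⟨p, q, A + (A₀ - A - B), B, ?_, ?_, hpq, by abel⟩
  · exact mem_closure_upperContactJet (huc.continuousAt (Metric.ball_mem_nhds x₀ hr))
      (hxt.comp hχ) (hat.comp hχ) hA' (fun k => hD _) (fun k => hHs _) (fun k => hHq _)
      ((hA₀.sub hAs).sub hBs) hAB
  · have h1 := mem_closure_upperContactJet (P := 0) (hvc.continuousAt (Metric.ball_mem_nhds x₀ hr))
      (hxt.comp hχ) (hat'.comp hχ) hB (fun k => hD' _) (fun k => hHs' _) (fun k => hHq' _)
      Matrix.isSymm_zero (fun z => by simp [quad])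
    rwa [add_zero] at h1
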